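/- A finite simple graph G is an interval graph (i.e., there is a family of nonempty closed intervals I v ⊆ ℝ, indexed by the vertices, such that distinct vertices u and v are adjacent in G iff I u ∩ I v ≠ ∅) if and only if G admits a grounded L-representation in which all bends lie on a common downward-sloping line, i.e., there exist m < 0 and c ∈ ℝ with −h v = m·(a v) + c for every vertex v. -/

import Mathlib

/-- The grounded L-shape with anchor `(a, 0)`, depth `h` and width `w`:
the union of the vertical segment from `(a, 0)` to `(a, -h)` and the
horizontal segment from `(a, -h)` to `(a + w, -h)`. -/
def LShape (a h w : ℝ) : Set (ℝ × ℝ) :=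
  segment ℝ ((a, 0) : ℝ × ℝ) ((a, -h) : ℝ × ℝ) ∪
    segment ℝ ((a, -h) : ℝ × ℝ) ((a + w, -h) : ℝ × ℝ)

/-- A grounded L-representation of a simple graph `G`. -/
structure GroundedLRep {V : Type} (G : SimpleGraph V) where
  a : V → ℝ
  ht : V → ℝ
  wd : V → ℝ
  ht_pos : ∀ v, 0 < ht v
  wd_pos : ∀ v, 0 < wd v
  a_inj : Function.Injective a
  ht_inj : Function.Injective ht
  endpoint_off : ∀ u v, u ≠ v →
    ((a v + wd v, -ht v) : ℝ × ℝ) ∉ LShape (a u) (ht u) (wd u)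
  adj_iff : ∀ u v, u ≠ v →
    (G.Adj u v ↔ (LShape (a u) (ht u) (wd u) ∩ LShape (a v) (ht v) (wd v)).Nonempty)

open Filter Topology

theorem mem_LShape_iff {a h w : ℝ} (hh : 0 ≤ h) (hw : 0 ≤ w) (x y : ℝ) :
    (x, y) ∈ LShape a h w ↔
      (x = a ∧ -h ≤ y ∧ y ≤ 0) ∨ (y = -h ∧ a ≤ x ∧ x ≤ a + w) := by
  rw [LShape, Set.mem_union, ← Prod.image_mk_segment_right, ← Prod.image_mk_segment_left,
    segment_symm, segment_eq_Icc (neg_nonpos.mpr hh), segment_eq_Icc (le_add_of_nonneg_right hw)]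
  simp only [Set.mem_image, Set.mem_Icc, Prod.mk.injEq]
  constructor
  · rintro (⟨z, hz, rfl, rfl⟩ | ⟨z, hz, rfl, rfl⟩)
    · exact Or.inl ⟨rfl, hz⟩
    · exact Or.inr ⟨rfl, hz⟩
  · rintro (⟨rfl, hz⟩ | ⟨rfl, hz⟩)
    · exact Or.inl ⟨y, hz, rfl, rfl⟩
    · exact Or.inr ⟨x, hz, rfl, rfl⟩

theorem LShape_inter_nonempty_iff_of_lt {a₁ h₁ w₁ a₂ h₂ w₂ : ℝ} (hh₁ : 0 < h₁) (hw₁ : 0 < w₁)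
    (hh₂ : 0 < h₂) (hw₂ : 0 < w₂) (ha : a₁ < a₂) (hh : h₁ < h₂) :
    (LShape a₁ h₁ w₁ ∩ LShape a₂ h₂ w₂).Nonempty ↔ a₂ ≤ a₁ + w₁ := by
  constructor
  · rintro ⟨⟨x, y⟩, h, h'⟩
    rw [mem_LShape_iff hh₁.le hw₁.le] at h
    rw [mem_LShape_iff hh₂.le hw₂.le] at h'
    rcases h with h | h <;> rcases h' with h' | h' <;> linarith
  · intro h
    refine ⟨(a₂, -h₁), ?_, ?_⟩
    · rw [mem_LShape_iff hh₁.le hw₁.le]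
      exact Or.inr ⟨rfl, ha.le, h⟩
    · rw [mem_LShape_iff hh₂.le hw₂.le]
      exact Or.inl ⟨rfl, by linarith, by linarith⟩

/-- When depth and anchor are ordered alike, two grounded L-shapes meet iff their projections to
the ground line do. -/
theorem LShape_inter_nonempty_iff {a₁ h₁ w₁ a₂ h₂ w₂ : ℝ} (hh₁ : 0 < h₁) (hw₁ : 0 < w₁)
    (hh₂ : 0 < h₂) (hw₂ : 0 < w₂) (ha : a₁ ≠ a₂) (h₁₂ : a₁ < a₂ → h₁ < h₂)
    (h₂₁ : a₂ < a₁ → h₂ < h₁) :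
    (LShape a₁ h₁ w₁ ∩ LShape a₂ h₂ w₂).Nonempty ↔ a₂ ≤ a₁ + w₁ ∧ a₁ ≤ a₂ + w₂ := by
  rcases ha.lt_or_gt with h | h
  · rw [LShape_inter_nonempty_iff_of_lt hh₁ hw₁ hh₂ hw₂ h (h₁₂ h)]
    exact ⟨fun h' => ⟨h', by linarith⟩, And.left⟩
  · rw [Set.inter_comm, LShape_inter_nonempty_iff_of_lt hh₂ hw₂ hh₁ hw₁ h (h₂₁ h)]
    exact ⟨fun h' => ⟨by linarith, h'⟩, And.right⟩

theorem Icc_inter_Icc_nonempty_iff {a b c d : ℝ} (hab : a ≤ b) (hcd : c ≤ d) :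
    (Set.Icc a b ∩ Set.Icc c d).Nonempty ↔ c ≤ b ∧ a ≤ d := by
  rw [Set.Icc_inter_Icc, Set.nonempty_Icc, sup_le_iff, le_inf_iff, le_inf_iff]
  tauto

theorem exists_pos_forall_mul_lt {ι : Type*} [Finite ι] (f : ι → ℝ) (k : ℝ) :
    ∃ δ > 0, ∀ i, 0 < f i → k * δ < f i := by
  have hev : ∀ᶠ δ in 𝓝[>] (0 : ℝ), ∀ i, 0 < f i → k * δ < f i := by
    refine eventually_all.mpr fun i => ?_
    by_cases hi : 0 < f i
    · have hlim : Tendsto (fun δ : ℝ => k * δ) (𝓝[>] 0) (𝓝 0) := by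
        have : Tendsto (fun δ : ℝ => k * δ) (𝓝 0) (𝓝 (k * 0)) :=
          (continuous_const_mul k).tendsto 0
        rw [mul_zero] at this
        exact this.mono_left nhdsWithin_le_nhds
      exact (hlim.eventually_lt_const hi).mono fun δ hδ _ => hδ
    · exact .of_forall fun δ h => absurd h hi
  exact (eventually_mem_nhdsWithin.and hev).exists

theorem exists_injective_mem_Ioc (V : Type*) [Finite V] :
    ∃ t : V → ℝ, Function.Injective t ∧ ∀ v, 0 < t v ∧ t v ≤ 1 := by
  obtain ⟨n, ⟨e⟩⟩ := Finite.exists_equiv_fin V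
  refine ⟨fun v => 1 / ((e v : ℕ) + 1 : ℝ), fun u v h => ?_, fun v => ⟨by positivity, ?_⟩⟩
  · simpa [Fin.val_inj] using h
  · rw [div_le_one (by positivity)]
    simp

/-- Any finite interval representation can be perturbed into one with positive distinct left
endpoints and in which no right endpoint is a left endpoint. -/
theorem exists_generic_intervals {V : Type*} [Finite V] (lo hi : V → ℝ)
    (hle : ∀ v, lo v ≤ hi v) :
    ∃ a b : V → ℝ, Function.Injective a ∧ (∀ v, 0 < a v) ∧ (∀ v, a v < b v) ∧
      (∀ u v, b v ≠ a u) ∧ ∀ u v, a u ≤ b v ↔ lo u ≤ hi v := by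
  obtain ⟨t, ht_inj, ht⟩ := exists_injective_mem_Ioc V
  obtain ⟨δ, hδ, hgap⟩ := exists_pos_forall_mul_lt
    (Sum.elim (fun p : V × V => lo p.1 - lo p.2) (fun p : V × V => lo p.1 - hi p.2)) 2
  have hgap_lo (u v : V) (h : lo v < lo u) : 2 * δ < lo u - lo v :=
    hgap (.inl (u, v)) (sub_pos.mpr h)
  have hgap_hi (u v : V) (h : hi v < lo u) : 2 * δ < lo u - hi v :=
    hgap (.inr (u, v)) (sub_pos.mpr h)
  obtain ⟨B, hB⟩ := (Set.finite_range lo).bddBelow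
  replace hB (v : V) : B ≤ lo v := hB ⟨v, rfl⟩
  have hpos (v : V) : 0 < δ * t v := mul_pos hδ (ht v).1
  have hone (v : V) : δ * t v ≤ δ := mul_le_of_le_one_right hδ.le (ht v).2
  refine ⟨fun v => lo v - δ * t v + (2 * δ - B), fun v => hi v + δ + (2 * δ - B),
    fun u v h => ?_, fun v => ?_, fun v => ?_, fun u v h => ?_, fun u v => ⟨fun h => ?_, fun h => ?_⟩⟩
  · have := hpos u
    have := hpos v
    have := hone u
    have := hone v
    simp only at h
    rcases lt_trichotomy (lo u) (lo v) with h' | h' | h'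
    · linarith [hgap_lo v u h']
    · exact ht_inj (mul_left_cancel₀ hδ.ne' (by linarith))
    · linarith [hgap_lo u v h']
  · linarith [hB v, hone v]
  · linarith [hle v, hpos v]
  · simp only at h
    linarith [hpos u, hone u, hgap_hi u v (by linarith [hpos u])]
  · by_contra! h'
    linarith [hone u, hgap_hi u v h']
  · linarith [hpos u]

/-- A finite simple graph is an interval graph iff it admits a
grounded L-representation in which all bends `(a v, -h v)` lie on a common
downward-sloping line. -/
theorem interval_iff_groundedL_bends_on_line {V : Type} [Fintype V]
    (G : SimpleGraph V) :
    (∃ lo hi : V → ℝ, (∀ v, lo v ≤ hi v) ∧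
      ∀ u v : V, u ≠ v →
        (G.Adj u v ↔ (Set.Icc (lo u) (hi u) ∩ Set.Icc (lo v) (hi v)).Nonempty)) ↔
    (∃ R : GroundedLRep G, ∃ m c : ℝ, m < 0 ∧ ∀ v, -R.ht v = m * R.a v + c) := by
  constructor
  · rintro ⟨lo, hi, hle, hadj⟩
    obtain ⟨a, b, ha_inj, ha, hab, hne, hiff⟩ := exists_generic_intervals lo hi hle
    have hw (v : V) : 0 < b v - a v := sub_pos.mpr (hab v)
    refine ⟨⟨a, a, fun v => b v - a v, ha, hw, ha_inj, ha_inj, fun u v huv hmem => ?_,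
      fun u v huv => ?_⟩, -1, 0, by norm_num, fun v => by simp⟩
    · rw [mem_LShape_iff (ha u).le (hw u).le, add_sub_cancel] at hmem
      rcases hmem with h | h
      · exact hne u v h.1
      · exact huv (ha_inj (neg_injective h.1)).symm
    · rw [LShape_inter_nonempty_iff (ha u) (hw u) (ha v) (hw v) (ha_inj.ne huv) id id,
        add_sub_cancel, add_sub_cancel, hadj u v huv, Icc_inter_Icc_nonempty_iff (hle u) (hle v),
        hiff, hiff]
  · rintro ⟨R, m, c, hm, hline⟩
    have hlt (u v : V) (h : R.a u < R.a v) : R.ht u < R.ht v := by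
      linarith [hline u, hline v, mul_lt_mul_of_neg_left h hm]
    have hle (v : V) : R.a v ≤ R.a v + R.wd v := le_add_of_nonneg_right (R.wd_pos v).le
    refine ⟨R.a, fun v => R.a v + R.wd v, hle, fun u v huv => ?_⟩
    rw [R.adj_iff u v huv, LShape_inter_nonempty_iff (R.ht_pos u) (R.wd_pos u) (R.ht_pos v)
      (R.wd_pos v) (R.a_inj.ne huv) (hlt u v) (hlt v u), Icc_inter_Icc_nonempty_iff (hle u) (hle v)]
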